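/- Let 1 ≤ k ≤ n and m ≥ 1. If there exists an S³-equivariant continuous map from the quaternionic Stiefel manifold ℍV_{n,k} to the unit sphere S^{4m−1} of ℍᵐ (equivariant with respect to the unit-quaternion actions by left scalar multiplication), then m ≥ n − k + 1. -/

import Mathlib

open scoped Quaternion
open Matrix

/-- The quaternionic Stiefel manifold `ℍV_{n,k}` of orthonormal `k`-frames in `ℍⁿ`,
realized as the space of `k × n` quaternionic matrices `A` with `A * Aᴴ = 1`, with the
subspace topology from the space of matrices. -/
abbrev QStiefel (n k : ℕ) : Type :=
  {A : Matrix (Fin k) (Fin n) ℍ[ℝ] // A * Aᴴ = 1}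

/-- The unit sphere `S^{4m-1}` in quaternionic `m`-space `ℍᵐ` (with the Euclidean
`L²` norm). -/
abbrev QSphere (m : ℕ) : Type :=
  Metric.sphere (0 : PiLp 2 fun _ : Fin m => ℍ[ℝ]) 1

section NormalForm

open MvPolynomial

variable {σ : Type*}

/-- The normal form of a monomial modulo the rewriting rules `X i ^ d i ↦ -g i`, where every
monomial of `g i` has smaller `w`-weight than `X i ^ d i`. -/
noncomputable def monomialNormalForm (d w : σ → ℕ) (g : σ → MvPolynomial σ ℝ)
    (hg : ∀ i, ∀ m ∈ (g i).support, Finsupp.weight w m < d i * w i) (b : σ →₀ ℕ) :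
    MvPolynomial σ ℝ :=
  open Classical in
  if h : ∃ i, d i ≤ b i then
    -∑ m ∈ (g h.choose).support.attach, (g h.choose).coeff m.1 •
      monomialNormalForm d w g hg (b - Finsupp.single h.choose (d h.choose) + m.1)
  else monomial b 1
termination_by Finsupp.weight w b
decreasing_by
  have h1 := hg _ m.1 m.2
  have h2 : b = (b - Finsupp.single h.choose (d h.choose)) +
      Finsupp.single h.choose (d h.choose) :=
    (tsub_add_cancel_of_le (Finsupp.single_le_iff.2 h.choose_spec)).symm
  have h3 := congrArg (Finsupp.weight w) h2
  rw [map_add, Finsupp.weight_single] at h3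
  rw [map_add]
  simp only [smul_eq_mul] at h3
  omega

/-- The linear extension of `monomialNormalForm`. -/
noncomputable def normalForm (d w : σ → ℕ) (g : σ → MvPolynomial σ ℝ)
    (hg : ∀ i, ∀ m ∈ (g i).support, Finsupp.weight w m < d i * w i) :
    MvPolynomial σ ℝ →ₗ[ℝ] MvPolynomial σ ℝ :=
  (basisMonomials σ ℝ).constr ℝ (monomialNormalForm d w g hg)

variable {d w : σ → ℕ} {g : σ → MvPolynomial σ ℝ}
  {hg : ∀ i, ∀ m ∈ (g i).support, Finsupp.weight w m < d i * w i}

lemma normalForm_monomial (b : σ →₀ ℕ) (c : ℝ) :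
    normalForm d w g hg (monomial b c) = c • monomialNormalForm d w g hg b := by
  have : monomial b c = c • basisMonomials σ ℝ b := by
    simp [smul_monomial]
  rw [this, map_smul, normalForm, Module.Basis.constr_basis]

lemma normalForm_monomial_of_forall_lt {b : σ →₀ ℕ} (hb : ∀ i, b i < d i) :
    normalForm d w g hg (monomial b 1) = monomial b 1 := by
  rw [normalForm_monomial, one_smul, monomialNormalForm, dif_neg]
  push Not
  exact hb

lemma exists_normalForm_monomial_eq {b : σ →₀ ℕ} (hb : ∃ i, d i ≤ b i) :
    ∃ i, d i ≤ b i ∧ normalForm d w g hg (monomial b 1) =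
      -normalForm d w g hg (monomial (b - Finsupp.single i (d i)) 1 * g i) := by
  refine ⟨hb.choose, hb.choose_spec, ?_⟩
  rw [normalForm_monomial, one_smul, monomialNormalForm, dif_pos hb]
  conv_rhs => rw [(g hb.choose).as_sum]
  rw [Finset.mul_sum, map_sum, ← Finset.sum_attach (g hb.choose).support]
  congr 1
  refine Finset.sum_congr rfl fun m _ ↦ ?_
  rw [monomial_mul, one_mul, normalForm_monomial]

lemma normalForm_mul_add_eq_zero (i : σ) (p : MvPolynomial σ ℝ) :
    normalForm d w g hg (p * (X i ^ d i + g i)) = 0 := by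
  have key : ∀ N : ℕ, ∀ (i : σ) (p : MvPolynomial σ ℝ),
      (∀ m ∈ p.support, Finsupp.weight w m + d i * w i < N) →
      normalForm d w g hg (p * X i ^ d i) = -normalForm d w g hg (p * g i) := by
    intro N
    induction N with
    | zero =>
      intro i p hp
      have : p = 0 := by
        rw [← support_eq_empty, Finset.eq_empty_iff_forall_notMem]
        exact fun m hm ↦ absurd (hp m hm) (by simp)
      simp [this]
    | succ N ih =>
      intro i p hp
      suffices h : ∀ m ∈ p.support, normalForm d w g hg (monomial m 1 * X i ^ d i) =
          -normalForm d w g hg (monomial m 1 * g i) by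
        have hsum : p = ∑ m ∈ p.support, p.coeff m • monomial m 1 := by
          conv_lhs => rw [p.as_sum]
          simp [smul_monomial]
        rw [hsum, Finset.sum_mul, Finset.sum_mul, map_sum, map_sum, ← Finset.sum_neg_distrib]
        refine Finset.sum_congr rfl fun m hm ↦ ?_
        rw [smul_mul_assoc, smul_mul_assoc, map_smul, map_smul, h m hm, smul_neg]
      intro m hm
      have hN := hp m hm
      rw [X_pow_eq_monomial, monomial_mul, one_mul]
      obtain ⟨j, hj, hj'⟩ := exists_normalForm_monomial_eq (g := g) (hg := hg)
        (b := m + Finsupp.single i (d i)) (d := d) ⟨i, by simp⟩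
      rw [hj']
      by_cases hij : j = i
      · subst hij
        simp
      have hmj : d j ≤ m j := by simpa [Finsupp.single_apply, Ne.symm hij] using hj
      obtain ⟨e, rfl⟩ : ∃ e, m = e + Finsupp.single j (d j) :=
        ⟨_, (tsub_add_cancel_of_le (Finsupp.single_le_iff.2 hmj)).symm⟩
      have hsw : e + Finsupp.single j (d j) + Finsupp.single i (d i) - Finsupp.single j (d j) =
          e + Finsupp.single i (d i) := by
        rw [add_right_comm, add_tsub_cancel_right]
      have hE (k : σ) : monomial (e + Finsupp.single k (d k)) (1 : ℝ) =
          monomial e 1 * X k ^ d k := by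
        rw [X_pow_eq_monomial, monomial_mul, one_mul]
      simp only [map_add, Finsupp.weight_single, smul_eq_mul] at hN
      have hlt (k l : σ) (hkl : Finsupp.weight w e + d k * w k + d l * w l < N + 1) :
          ∀ m ∈ (monomial e 1 * g k).support, Finsupp.weight w m + d l * w l < N := by
        classical
        intro m hm
        obtain ⟨a, ha, b, hb, rfl⟩ := Finset.mem_add.1 (support_mul _ _ hm)
        have ha' : a = e := by simpa using support_monomial_subset ha
        have := hg k b hb
        rw [map_add, ha']
        omega
      rw [hsw, hE, hE, mul_right_comm, ih i _ (hlt j i hN), mul_right_comm _ (X j ^ d j),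
        ih j _ (hlt i j (by omega)), mul_right_comm]
  rw [mul_add, map_add, key (p.support.sup (fun m ↦ Finsupp.weight w m + d i * w i) + 1) i p,
    neg_add_cancel]
  exact fun m hm ↦ Nat.lt_succ_of_le
    (Finset.le_sup (f := fun m ↦ Finsupp.weight w m + d i * w i) hm)

/-- The ideal of the rewriting rules `X i ^ d i ↦ -g i`. -/
noncomputable def rewriteIdeal (d : σ → ℕ) (g : σ → MvPolynomial σ ℝ) :
    Ideal (MvPolynomial σ ℝ) :=
  Ideal.span (Set.range fun i ↦ X i ^ d i + g i)

lemma normalForm_eq_zero_of_mem {p : MvPolynomial σ ℝ} (hp : p ∈ rewriteIdeal d g) :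
    normalForm d w g hg p = 0 := by
  induction hp using Submodule.span_induction with
  | mem x h =>
    obtain ⟨i, rfl⟩ := h
    simpa using normalForm_mul_add_eq_zero (hg := hg) i 1
  | zero => simp
  | add x y _ _ hx hy => rw [map_add, hx, hy, add_zero]
  | smul a x hx h =>
    clear h
    revert a
    induction hx using Submodule.span_induction with
    | mem x h =>
      obtain ⟨i, rfl⟩ := h
      exact normalForm_mul_add_eq_zero i
    | zero => simp
    | add x y _ _ hx hy => intro a; rw [smul_add, map_add, hx, hy, add_zero]
    | smul b x _ h => intro a; rw [← mul_smul]; exact h _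

variable (d) in
/-- The reduced monomials of even degree. -/
def evenReduced : Set (σ →₀ ℕ) := {e | (∀ i, e i < d i) ∧ Even e.degree}

/-- Even monomials are, modulo the rewriting rules, combinations of even reduced monomials,
provided that the rules preserve parity. -/
lemma mk_monomial_mem_span (hg : ∀ i, ∀ m ∈ (g i).support, Finsupp.weight w m < d i * w i)
    (hpar : ∀ i, ∀ m ∈ (g i).support, (Even m.degree ↔ Even (d i)))
    (b : σ →₀ ℕ) (hb : Even b.degree) :
    Ideal.Quotient.mkₐ ℝ (rewriteIdeal d g) (monomial b 1) ∈ Submodule.span ℝ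
      (Set.range fun e : evenReduced d ↦
        Ideal.Quotient.mkₐ ℝ (rewriteIdeal d g) (monomial e.1 1)) := by
  induction hN : Finsupp.weight w b using Nat.strong_induction_on generalizing b with
  | _ N ih =>
  by_cases h : ∃ i, d i ≤ b i
  · obtain ⟨i, hi⟩ := h
    obtain ⟨e, rfl⟩ : ∃ e, b = e + Finsupp.single i (d i) :=
      ⟨_, (tsub_add_cancel_of_le (Finsupp.single_le_iff.2 hi)).symm⟩
    have h1 : Ideal.Quotient.mkₐ ℝ (rewriteIdeal d g) (monomial e 1 * (X i ^ d i + g i)) = 0 := by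
      rw [Ideal.Quotient.mkₐ_eq_mk, Ideal.Quotient.eq_zero_iff_mem]
      exact Ideal.mul_mem_left _ _ (Ideal.subset_span ⟨i, rfl⟩)
    rw [mul_add, map_add, X_pow_eq_monomial, monomial_mul, one_mul] at h1
    rw [eq_neg_of_add_eq_zero_left h1]
    refine Submodule.neg_mem _ ?_
    rw [(g i).as_sum, Finset.mul_sum, map_sum]
    refine Submodule.sum_mem _ fun m hm ↦ ?_
    have : monomial e 1 * monomial m ((g i).coeff m) = (g i).coeff m • monomial (e + m) 1 := by
      simp [smul_monomial, monomial_mul]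
    rw [this, map_smul]
    refine Submodule.smul_mem _ _ (ih _ ?_ _ ?_ rfl)
    · have := hg i m hm
      simp only [map_add, Finsupp.weight_single, smul_eq_mul] at hN ⊢
      omega
    · have := hpar i m hm
      simp only [map_add, Finsupp.degree_single, Nat.even_add] at hb ⊢
      tauto
  · push Not at h
    exact Submodule.subset_span ⟨⟨b, h, hb⟩, rfl⟩

lemma linearIndependent_mk_monomial
    (hg : ∀ i, ∀ m ∈ (g i).support, Finsupp.weight w m < d i * w i) :
    LinearIndependent ℝ fun e : evenReduced d ↦
        Ideal.Quotient.mkₐ ℝ (rewriteIdeal d g) (monomial e.1 1) := by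
  rw [linearIndependent_iff]
  intro l hl
  have h1 : Finsupp.linearCombination ℝ (fun e : evenReduced d ↦ monomial e.1 (1 : ℝ)) l ∈
      rewriteIdeal d g := by
    rw [← Ideal.Quotient.eq_zero_iff_mem, ← hl, ← Ideal.Quotient.mkₐ_eq_mk ℝ,
      Finsupp.linearCombination_apply, Finsupp.linearCombination_apply, map_finsuppSum]
    simp
  have h2 := normalForm_eq_zero_of_mem (hg := hg) h1
  rw [Finsupp.linearCombination_apply, map_finsuppSum] at h2
  simp only [map_smul] at h2
  have h3 : (l.sum fun (e : evenReduced d) c ↦ c • normalForm d w g hg (monomial e.1 1)) =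
      Finsupp.linearCombination ℝ (fun e : evenReduced d ↦ monomial e.1 (1 : ℝ)) l := by
    rw [Finsupp.linearCombination_apply]
    refine Finsupp.sum_congr fun e _ ↦ ?_
    rw [normalForm_monomial_of_forall_lt e.2.1]
  rw [h3] at h2
  have h4 : LinearIndependent ℝ fun e : evenReduced d ↦ monomial e.1 (1 : ℝ) := by
    have := (basisMonomials σ ℝ).linearIndependent.comp
      (Subtype.val : evenReduced d → _) Subtype.val_injective
    simpa [Function.comp_def] using this
  exact linearIndependent_iff.1 h4 l h2

variable (σ) in
/-- The subalgebra of polynomials all of whose monomials have even degree. -/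
def evenSubalgebra : Subalgebra ℝ (MvPolynomial σ ℝ) where
  carrier := {p | ∀ m ∈ p.support, Even m.degree}
  mul_mem' {p q} hp hq m hm := by
    classical
    obtain ⟨a, ha, b, hb, rfl⟩ := Finset.mem_add.1 (support_mul _ _ hm)
    rw [map_add]
    exact (hp a ha).add (hq b hb)
  add_mem' {p q} hp hq m hm := by
    classical
    rcases Finset.mem_union.1 (support_add hm) with h | h
    exacts [hp m h, hq m h]
  algebraMap_mem' r m hm := by
    have : m = 0 := by
      simpa using support_monomial_subset (s := 0) (a := r) hm
    simp [this]

lemma map_evenSubalgebra_eq_span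
    (hg : ∀ i, ∀ m ∈ (g i).support, Finsupp.weight w m < d i * w i)
    (hpar : ∀ i, ∀ m ∈ (g i).support, (Even m.degree ↔ Even (d i))) :
    Subalgebra.toSubmodule
      ((evenSubalgebra σ).map (Ideal.Quotient.mkₐ ℝ (rewriteIdeal d g))) =
    Submodule.span ℝ (Set.range fun e : evenReduced d ↦
        Ideal.Quotient.mkₐ ℝ (rewriteIdeal d g) (monomial e.1 1)) := by
  apply le_antisymm
  · rintro _ ⟨p, hp, rfl⟩
    rw [p.as_sum]
    change Ideal.Quotient.mkₐ ℝ (rewriteIdeal d g) _ ∈ _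
    rw [map_sum]
    refine Submodule.sum_mem _ fun m hm ↦ ?_
    have : monomial m (p.coeff m) = p.coeff m • monomial m (1 : ℝ) := by simp [smul_monomial]
    rw [this, map_smul]
    exact Submodule.smul_mem _ _ (mk_monomial_mem_span hg hpar m (hp m hm))
  · rw [Submodule.span_le]
    rintro _ ⟨e, rfl⟩
    refine ⟨monomial e.1 1, fun m hm ↦ ?_, rfl⟩
    have : m = e.1 := by simpa using support_monomial_subset hm
    rw [this]
    exact e.2.2

end NormalForm

section RealPoints

open MvPolynomial

lemma exists_maximal_finrank_quotient_eq_one {C : Type*} [CommRing C] [Algebra ℝ C]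
    [FiniteDimensional ℝ C] (N : ℕ) (M : Type*) [AddCommGroup M] [Module C M] [Module ℝ M]
    [IsScalarTower ℝ C M] [FiniteDimensional ℝ M] (hN : Module.finrank ℝ M = N) (hodd : Odd N) :
    ∃ I : Ideal C, I.IsMaximal ∧ Module.finrank ℝ (C ⧸ I) = 1 := by
  induction N using Nat.strong_induction_on generalizing M with
  | _ N ih =>
  have hpos : 0 < Module.finrank ℝ M := hN ▸ hodd.pos
  have : Nontrivial M := Module.nontrivial_of_finrank_pos hpos
  have : Module.Finite C M := Module.Finite.of_restrictScalars_finite ℝ C M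
  obtain ⟨K, hK, -⟩ := (eq_top_or_exists_le_coatom (⊥ : Submodule C M)).resolve_left bot_ne_top
  have hsimple : IsSimpleModule C (M ⧸ K) := isSimpleModule_iff_isCoatom.2 hK
  obtain ⟨I, hI, ⟨e⟩⟩ := isSimpleModule_iff_quot_maximal.1 hsimple
  have hfin : Module.finrank ℝ (M ⧸ K) = Module.finrank ℝ (C ⧸ I) :=
    (e.restrictScalars ℝ).finrank_eq
  have hsum : Module.finrank ℝ (M ⧸ K) + Module.finrank ℝ K = Module.finrank ℝ M :=
    (K.restrictScalars ℝ).finrank_quotient_add_finrank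
  have : IsScalarTower ℝ C K := inferInstance
  have : FiniteDimensional ℝ K := inferInstanceAs (FiniteDimensional ℝ (K.restrictScalars ℝ))
  let _ : Field (C ⧸ I) := Ideal.Quotient.field I
  rcases Real.nonempty_algEquiv_or (C ⧸ I) with ⟨⟨e'⟩⟩ | ⟨⟨e'⟩⟩
  · exact ⟨I, hI, by rw [e'.toLinearEquiv.finrank_eq, Module.finrank_self]⟩
  · have h2 : Module.finrank ℝ (C ⧸ I) = 2 := by
      rw [e'.toLinearEquiv.finrank_eq, Complex.finrank_real_complex]
    refine ih (Module.finrank ℝ K) (by omega) K rfl ?_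
    rw [← hN, ← hsum, hfin, h2, Nat.odd_add'] at hodd
    exact hodd.2 even_two

lemma nonempty_algHom_real_of_odd_finrank {C : Type*} [CommRing C] [Algebra ℝ C]
    [FiniteDimensional ℝ C] (hodd : Odd (Module.finrank ℝ C)) : Nonempty (C →ₐ[ℝ] ℝ) := by
  obtain ⟨I, hI, h1⟩ := exists_maximal_finrank_quotient_eq_one (C := C) _ C rfl hodd
  let _ : Field (C ⧸ I) := Ideal.Quotient.field I
  rcases Real.nonempty_algEquiv_or (C ⧸ I) with ⟨⟨e⟩⟩ | ⟨⟨e⟩⟩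
  · exact ⟨e.toAlgHom.comp (Ideal.Quotient.mkₐ ℝ I)⟩
  · rw [e.toLinearEquiv.finrank_eq, Complex.finrank_real_complex] at h1
    omega

variable {τ : Type*} [Fintype τ]

/-- An even reduced exponent is determined by its `some` coordinates. -/
noncomputable def evenReducedEquiv (D : ℕ) :
    evenReduced (fun o : Option τ ↦ o.elim 2 fun _ ↦ D) ≃ (τ → Fin D) where
  toFun e i := ⟨e.1 (some i), e.2.1 (some i)⟩
  invFun a := ⟨Finsupp.equivFunOnFinite.symm fun o ↦ o.elim ((∑ i, (a i : ℕ)) % 2) fun i ↦ a i, by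
    constructor
    · rintro (_ | i)
      · exact Nat.mod_lt _ two_pos
      · exact (a i).2
    · rw [Finsupp.degree_eq_sum, Fintype.sum_option]
      simp only [Finsupp.equivFunOnFinite_symm_apply_apply, Option.elim]
      rw [Nat.even_iff]
      omega⟩
  left_inv e := by
    ext o
    have h := e.2.2
    have h0 := e.2.1 none
    rw [Finsupp.degree_eq_sum, Fintype.sum_option, Nat.even_iff] at h
    rcases o with _ | i
    · simp only [Finsupp.equivFunOnFinite_symm_apply_apply, Option.elim] at h0 ⊢
      omega
    · rfl
  right_inv a := by
    ext i
    rfl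

/-- A system of rewriting rules with odd exponents on the sphere admits a real character of the
even part of its coordinate ring. -/
lemma exists_even_character (D : ℕ) (hD : Odd D) (w : Option τ → ℕ)
    (g : Option τ → MvPolynomial (Option τ) ℝ)
    (hg : ∀ i, ∀ m ∈ (g i).support,
      Finsupp.weight w m < (i.elim 2 fun _ ↦ D : ℕ) * w i)
    (hpar : ∀ i, ∀ m ∈ (g i).support, (Even m.degree ↔ Even (i.elim 2 fun _ ↦ D : ℕ))) :
    ∃ Ψ : MvPolynomial (Option τ) ℝ →ₗ[ℝ] ℝ, Ψ 1 = 1 ∧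
      (∀ p ∈ evenSubalgebra (Option τ), ∀ q ∈ evenSubalgebra (Option τ),
        Ψ (p * q) = Ψ p * Ψ q) ∧
      ∀ p ∈ evenSubalgebra (Option τ),
        p ∈ rewriteIdeal (fun i ↦ i.elim 2 fun _ ↦ D) g → Ψ p = 0 := by
  classical
  set d : Option τ → ℕ := fun i ↦ i.elim 2 fun _ ↦ D with hd
  set C := (evenSubalgebra (Option τ)).map (Ideal.Quotient.mkₐ ℝ (rewriteIdeal d g)) with hC
  have : Fintype (evenReduced d) := Fintype.ofEquiv _ (evenReducedEquiv D).symm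
  have hspan := map_evenSubalgebra_eq_span hg hpar
  have hfd : FiniteDimensional ℝ (Subalgebra.toSubmodule C) := by
    rw [hspan]
    exact FiniteDimensional.span_of_finite ℝ (Set.finite_range _)
  have hfd' : FiniteDimensional ℝ C := hfd
  have hrank : Module.finrank ℝ C = D ^ Fintype.card τ := by
    change Module.finrank ℝ (Subalgebra.toSubmodule C) = _
    rw [hspan, finrank_span_eq_card (linearIndependent_mk_monomial hg),
      Fintype.card_congr (evenReducedEquiv D)]
    simp
  obtain ⟨φ⟩ := nonempty_algHom_real_of_odd_finrank (C := C) (hrank ▸ hD.pow)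
  let ι : evenSubalgebra (Option τ) →ₐ[ℝ] C :=
    ((Ideal.Quotient.mkₐ ℝ (rewriteIdeal d g)).comp (evenSubalgebra (Option τ)).val).codRestrict C
      fun p ↦ ⟨p.1, p.2, rfl⟩
  let ψ := φ.comp ι
  obtain ⟨Ψ, hΨ⟩ := LinearMap.exists_extend
    (p := Subalgebra.toSubmodule (evenSubalgebra (Option τ))) ψ.toLinearMap
  have hext (p) (hp : p ∈ evenSubalgebra (Option τ)) : Ψ p = ψ ⟨p, hp⟩ :=
    LinearMap.congr_fun hΨ ⟨p, hp⟩
  refine ⟨Ψ, ?_, ?_, ?_⟩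
  · rw [hext 1 (one_mem _)]
    exact map_one ψ
  · intro p hp q hq
    rw [hext p hp, hext q hq, hext _ (mul_mem hp hq), ← map_mul]
    rfl
  · intro p hp hpI
    have : ι ⟨p, hp⟩ = 0 := Subtype.ext (Ideal.Quotient.eq_zero_iff_mem.2 hpI)
    rw [hext p hp]
    change φ (ι _) = 0
    rw [this, map_zero]

lemma X_mul_X_mem_evenSubalgebra {σ : Type*} (a b : σ) :
    (X a * X b : MvPolynomial σ ℝ) ∈ evenSubalgebra σ := by
  intro m hm
  rw [X, X, monomial_mul] at hm
  rw [Finset.mem_singleton.1 (support_monomial_subset hm)]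
  simp

/-- A character of the even polynomials which is positive on the square of some variable is
evaluation at a real point. -/
lemma eval_eq_of_even_character {σ : Type*} (Ψ : MvPolynomial σ ℝ →ₗ[ℝ] ℝ) (h1 : Ψ 1 = 1)
    (hmul : ∀ p ∈ evenSubalgebra σ, ∀ q ∈ evenSubalgebra σ, Ψ (p * q) = Ψ p * Ψ q)
    (c : σ) (hc : 0 < Ψ (X c * X c)) (p : MvPolynomial σ ℝ) (hp : p ∈ evenSubalgebra σ) :
    Ψ p = eval (fun a ↦ Ψ (X a * X c) / √(Ψ (X c * X c))) p := by
  have hpow (q) (hq : q ∈ evenSubalgebra σ) (n : ℕ) : Ψ (q ^ n) = Ψ q ^ n := by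
    induction n with
    | zero => simp [h1]
    | succ n ih => rw [pow_succ, hmul _ (pow_mem hq n) _ hq, ih, pow_succ]
  have hprod (s : Finset σ) (F : σ → MvPolynomial σ ℝ) (hF : ∀ i, F i ∈ evenSubalgebra σ) :
      Ψ (∏ i ∈ s, F i) = ∏ i ∈ s, Ψ (F i) := by
    classical
    induction s using Finset.induction_on with
    | empty => simp [h1]
    | insert a s ha ih =>
      rw [Finset.prod_insert ha, Finset.prod_insert ha,
        hmul _ (hF a) _ (prod_mem fun i _ ↦ hF i), ih]
  set r := √(Ψ (X c * X c)) with hr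
  have hr0 : 0 < r := Real.sqrt_pos.2 hc
  have hr2 : Ψ (X c * X c) = r ^ 2 := (Real.sq_sqrt hc.le).symm
  have hmon (m : σ →₀ ℕ) (hm : Even m.degree) :
      Ψ (monomial m 1) = eval (fun a ↦ Ψ (X a * X c) / r) (monomial m 1) := by
    obtain ⟨k, hk⟩ := hm
    have hdeg : ∑ i ∈ m.support, m i = k + k := by rw [← hk]; rfl
    have e1 : monomial m 1 * (X c * X c) ^ k =
        ∏ i ∈ m.support, (X i * X c : MvPolynomial σ ℝ) ^ m i := by
      simp_rw [mul_pow]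
      rw [Finset.prod_mul_distrib, Finset.prod_pow_eq_pow_sum, hdeg, monomial_eq, pow_add]
      simp [Finsupp.prod]
    have e2 := congrArg Ψ e1
    have hmm : monomial m (1 : ℝ) ∈ evenSubalgebra σ := by
      intro m' hm'
      have : m' = m := by simpa using support_monomial_subset hm'
      rw [this, hk]
      exact ⟨k, rfl⟩
    rw [hmul _ hmm _ (pow_mem (X_mul_X_mem_evenSubalgebra c c) k),
      hpow _ (X_mul_X_mem_evenSubalgebra c c), hr2,
      hprod _ _ fun i ↦ pow_mem (X_mul_X_mem_evenSubalgebra i c) _] at e2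
    rw [eval_monomial, one_mul, Finsupp.prod]
    simp_rw [div_pow]
    rw [Finset.prod_div_distrib, Finset.prod_pow_eq_pow_sum, hdeg, eq_div_iff (by positivity),
      ← two_mul, pow_mul, e2]
    exact Finset.prod_congr rfl fun i _ ↦ hpow _ (X_mul_X_mem_evenSubalgebra i c) _
  rw [p.as_sum, map_sum, map_sum]
  refine Finset.sum_congr rfl fun m hm ↦ ?_
  have : monomial m (p.coeff m) = p.coeff m • monomial m (1 : ℝ) := by simp [smul_monomial]
  rw [this, map_smul, hmon m (hp m hm), smul_eval, smul_eq_mul]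

/-- Odd polynomials in one more variable than their number, perturbed by a suitable
high odd power of the variables, have a common zero on the sphere. -/
theorem exists_zero_pow_add_odd (q : τ → MvPolynomial (Option τ) ℝ)
    (hq : ∀ i, ∀ m ∈ (q i).support, Odd m.degree) :
    ∃ (D : ℕ) (x : Option τ → ℝ), Odd D ∧ ∑ a, x a ^ 2 = 1 ∧
      ∀ i, x (some i) ^ D + eval x (q i) = 0 := by
  let w : Option τ → ℕ := fun o ↦ o.elim 2 fun _ ↦ 1
  let B := Finset.univ.sup fun i ↦ (q i).support.sup fun m ↦ Finsupp.weight w m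
  have hB (i : τ) (m) (hm : m ∈ (q i).support) : Finsupp.weight w m ≤ B :=
    (Finset.le_sup (f := fun m ↦ Finsupp.weight w m) hm).trans
      (Finset.le_sup (f := fun i ↦ (q i).support.sup fun m ↦ Finsupp.weight w m)
        (Finset.mem_univ i))
  let D := 2 * B + 1
  have hD : Odd D := ⟨B, rfl⟩
  let g : Option τ → MvPolynomial (Option τ) ℝ :=
    fun o ↦ o.elim (∑ i, X (some i) ^ 2 - 1) q
  have hg0 (m) (hm : m ∈ (g none).support) : m = 0 ∨ ∃ i, m = Finsupp.single (some i) 2 := by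
    classical
    rcases Finset.mem_union.1 (support_sub _ _ _ hm) with h | h
    · right
      obtain ⟨i, -, hi⟩ := Finset.mem_biUnion.1 (support_sum h)
      rw [X_pow_eq_monomial] at hi
      exact ⟨i, by simpa using support_monomial_subset hi⟩
    · left
      simpa using support_monomial_subset (s := 0) (a := (1 : ℝ)) h
  obtain ⟨Ψ, h1, hmul, hI⟩ := exists_even_character D hD w g (by
    rintro (_ | i) m hm
    · rcases hg0 m hm with rfl | ⟨i, rfl⟩ <;> simp [w, Finsupp.weight_single]
    · have := hB i m hm
      simp only [Option.elim, w, D] at this ⊢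
      omega) (by
    rintro (_ | i) m hm
    · rcases hg0 m hm with rfl | ⟨i, rfl⟩ <;> simp
    · have := hq i m hm
      simp only [Option.elim]
      simp [← Nat.not_odd_iff_even, hD, this])
  have hsum : ∑ a : Option τ, Ψ (X a * X a) = 1 := by
    have h0 := hI (X none ^ 2 + g none) ?_ (Ideal.subset_span ⟨none, rfl⟩)
    · simp only [g, Option.elim] at h0
      rw [map_add, map_sub, map_sum, h1] at h0
      rw [Fintype.sum_option]
      simp only [← sq]
      linarith
    · refine add_mem ?_ (sub_mem (sum_mem fun i _ ↦ ?_) (one_mem _))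
      · rw [sq]; exact X_mul_X_mem_evenSubalgebra _ _
      · rw [sq]; exact X_mul_X_mem_evenSubalgebra _ _
  obtain ⟨c, -, hc⟩ : ∃ c ∈ Finset.univ, 0 < Ψ (X c * X c) := by
    by_contra! h
    exact absurd (Finset.sum_nonpos h) (by rw [hsum]; norm_num)
  have heval := eval_eq_of_even_character Ψ h1 hmul c hc
  set x : Option τ → ℝ := fun a ↦ Ψ (X a * X c) / √(Ψ (X c * X c)) with hx
  have hxc : x c ≠ 0 := (div_pos hc (Real.sqrt_pos.2 hc)).ne'
  refine ⟨D, x, hD, ?_, fun i ↦ ?_⟩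
  · rw [← hsum]
    refine Finset.sum_congr rfl fun a _ ↦ ?_
    rw [heval _ (X_mul_X_mem_evenSubalgebra a a), map_mul, eval_X, sq]
  · have hmem : (X (some i) ^ D + g (some i)) * X c ∈ evenSubalgebra (Option τ) := by
      classical
      intro m hm
      obtain ⟨a, ha, b, hb, rfl⟩ := Finset.mem_add.1 (support_mul _ _ hm)
      have hb' : b = Finsupp.single c 1 := by simpa using support_monomial_subset hb
      have ha' : Odd a.degree := by
        rcases Finset.mem_union.1 (support_add ha) with h | h
        · rw [X_pow_eq_monomial] at h
          rw [Finset.mem_singleton.1 (support_monomial_subset h), Finsupp.degree_single]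
          exact hD
        · exact hq i a h
      rw [map_add, hb', Finsupp.degree_single]
      exact ha'.add_one
    have h0 := hI _ hmem (Ideal.mul_mem_right _ _ (Ideal.subset_span ⟨some i, rfl⟩))
    rw [heval _ hmem, map_mul, eval_X, map_add, map_pow, eval_X] at h0
    exact (mul_eq_zero.1 h0).resolve_right hxc

end RealPoints

section BorsukUlam

open MvPolynomial

/-- Polynomials are uniformly dense in the continuous functions on a compact set. -/
lemma exists_mvPolynomial_near {ι : Type*} {S : Set (ι → ℝ)} (hS : IsCompact S)
    (f : S → ℝ) (hf : Continuous f) {ε : ℝ} (hε : 0 < ε) :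
    ∃ p : MvPolynomial ι ℝ, ∀ x : S, |eval x.1 p - f x| < ε := by
  have : CompactSpace S := isCompact_iff_compactSpace.1 hS
  let c : ι → C(S, ℝ) := fun i ↦ ⟨fun x ↦ x.1 i, (continuous_apply i).comp continuous_subtype_val⟩
  let Φ : MvPolynomial ι ℝ →ₐ[ℝ] C(S, ℝ) := aeval c
  have hΦ (p : MvPolynomial ι ℝ) (x : S) : Φ p x = eval x.1 p := by
    have h := DFunLike.congr_fun (show
      ((ContinuousMap.evalAlgHom ℝ ℝ x).comp Φ : MvPolynomial ι ℝ →ₐ[ℝ] ℝ) = aeval x.1 from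
        algHom_ext fun i ↦ by simp [Φ, c]) p
    simpa [coe_aeval_eq_eval] using h
  have hsep : Φ.range.SeparatesPoints := by
    intro x y hxy
    obtain ⟨i, hi⟩ : ∃ i, x.1 i ≠ y.1 i := by
      by_contra! h
      exact hxy (Subtype.ext (funext h))
    refine ⟨_, ⟨Φ (X i), ⟨X i, rfl⟩, rfl⟩, ?_⟩
    simpa [hΦ] using hi
  obtain ⟨⟨_, p, rfl⟩, hp⟩ :=
    ContinuousMap.exists_mem_subalgebra_near_continuous_of_separatesPoints Φ.range hsep f hf ε hε
  refine ⟨p, fun x ↦ ?_⟩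
  rw [← hΦ]
  exact hp x

/-- The odd part of a polynomial. -/
lemma exists_odd_part {ι : Type*} (p : MvPolynomial ι ℝ) :
    ∃ q : MvPolynomial ι ℝ, (∀ m ∈ q.support, Odd m.degree) ∧
      ∀ x, eval x q = (eval x p - eval (-x) p) / 2 := by
  classical
  refine ⟨∑ m ∈ p.support with Odd m.degree, monomial m (p.coeff m), fun m hm ↦ ?_, fun x ↦ ?_⟩
  · obtain ⟨i, hi, hm⟩ := Finset.mem_biUnion.1 (support_sum hm)
    rw [Finset.mem_singleton.1 (support_monomial_subset hm)]
    exact (Finset.mem_filter.1 hi).2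
  · have hneg (m : ι →₀ ℕ) (c : ℝ) :
        eval (-x) (monomial m c) = (-1) ^ m.degree * eval x (monomial m c) := by
      rw [eval_monomial, eval_monomial, Finsupp.prod, Finsupp.prod, Finsupp.degree_apply,
        ← Finset.prod_pow_eq_pow_sum, mul_left_comm, ← Finset.prod_mul_distrib]
      congr 1
      refine Finset.prod_congr rfl fun i _ ↦ ?_
      rw [Pi.neg_apply, neg_pow]
    conv_rhs => rw [p.as_sum]
    rw [map_sum, map_sum, map_sum, ← Finset.sum_sub_distrib, Finset.sum_div, Finset.sum_filter]
    refine Finset.sum_congr rfl fun m _ ↦ ?_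
    rw [hneg]
    split_ifs with h
    · rw [h.neg_one_pow]; ring
    · rw [(Nat.not_odd_iff_even.1 h).neg_one_pow]; ring

/-- The Euclidean unit sphere in `ℝ^ι`. -/
def coordSphere (ι : Type*) [Fintype ι] : Set (ι → ℝ) := {x | ∑ i, x i ^ 2 = 1}

lemma abs_le_one_of_mem_coordSphere {ι : Type*} [Fintype ι] {x : ι → ℝ}
    (hx : x ∈ coordSphere ι) (i : ι) : |x i| ≤ 1 := by
  rw [← sq_le_one_iff_abs_le_one, ← show ∑ i, x i ^ 2 = 1 from hx]
  exact Finset.single_le_sum (f := fun i ↦ x i ^ 2) (fun i _ ↦ sq_nonneg _) (Finset.mem_univ i)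

lemma isCompact_coordSphere (ι : Type*) [Fintype ι] : IsCompact (coordSphere ι) := by
  refine Metric.isCompact_of_isClosed_isBounded ?_ ?_
  · exact isClosed_eq (by fun_prop) continuous_const
  · refine (Metric.isBounded_closedBall (x := (0 : ι → ℝ)) (r := 1)).subset fun x hx ↦ ?_
    rw [mem_closedBall_zero_iff, pi_norm_le_iff_of_nonneg zero_le_one]
    exact abs_le_one_of_mem_coordSphere hx

lemma neg_mem_coordSphere {ι : Type*} [Fintype ι] {x : ι → ℝ} (hx : x ∈ coordSphere ι) :
    -x ∈ coordSphere ι := by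
  simpa [coordSphere] using hx

/-- The Borsuk–Ulam theorem, with one source coordinate singled out. -/
theorem exists_eq_zero_of_odd_option {τ : Type*} [Fintype τ]
    (f : coordSphere (Option τ) → τ → ℝ) (hf : Continuous f)
    (hodd : ∀ x y : coordSphere (Option τ), y.1 = -x.1 → f y = -f x) : ∃ x, f x = 0 := by
  by_contra! hne
  have : CompactSpace (coordSphere (Option τ)) :=
    isCompact_iff_compactSpace.1 (isCompact_coordSphere _)
  have : Nonempty (coordSphere (Option τ)) :=
    ⟨⟨fun o ↦ o.elim 1 fun _ ↦ 0, by simp [coordSphere, Fintype.sum_option]⟩⟩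
  obtain ⟨x₀, -, hx₀⟩ := isCompact_univ.exists_isMinOn Set.univ_nonempty hf.norm.continuousOn
  set δ := ‖f x₀‖ with hδ
  have hδ0 : 0 < δ := norm_pos_iff.2 (hne x₀)
  have hmin (x) : δ ≤ ‖f x‖ := hx₀ (Set.mem_univ x)
  choose p hp using fun i ↦ exists_mvPolynomial_near (isCompact_coordSphere (Option τ))
    (fun x ↦ f x i) (by fun_prop) (show 0 < δ / 3 by positivity)
  choose q hq hqp using fun i ↦ exists_odd_part (p i)
  obtain ⟨D, x, -, hx, hzero⟩ := exists_zero_pow_add_odd (fun i ↦ (3 / δ) • q i)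
    fun i m hm ↦ hq i m (support_smul hm)
  refine (hmin ⟨x, hx⟩).not_gt ((pi_norm_lt_iff hδ0).2 fun i ↦ ?_)
  have h1 := hp i ⟨x, hx⟩
  have h2 := hp i ⟨-x, neg_mem_coordSphere hx⟩
  rw [hodd ⟨x, hx⟩ ⟨-x, neg_mem_coordSphere hx⟩ rfl] at h2
  have h3 : |x (some i) ^ D| ≤ 1 := by
    rw [abs_pow]
    exact pow_le_one₀ (abs_nonneg _) (abs_le_one_of_mem_coordSphere hx _)
  have h4 := hzero i
  rw [smul_eval, hqp] at h4
  have h5 : (eval x (p i) - eval (-x) (p i)) / 2 = -(δ / 3) * x (some i) ^ D := by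
    field_simp at h4 ⊢
    linarith
  rw [abs_lt] at h1 h2
  rw [abs_le] at h3
  rw [Real.norm_eq_abs, abs_lt]
  simp only [Pi.neg_apply] at h2
  constructor <;> nlinarith

/-- The Borsuk–Ulam theorem: an odd continuous map from a sphere to a Euclidean space of
dimension at most that of the sphere has a zero. -/
theorem exists_eq_zero_of_odd {ι κ : Type*} [Fintype ι] [Fintype κ]
    (hcard : Fintype.card κ < Fintype.card ι)
    (f : coordSphere ι → κ → ℝ) (hf : Continuous f)
    (hodd : ∀ x y : coordSphere ι, y.1 = -x.1 → f y = -f x) : ∃ x, f x = 0 := by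
  let e : Option (Fin (Fintype.card ι - 1)) ≃ ι := Fintype.equivOfCardEq (by simp; omega)
  obtain ⟨j⟩ : Nonempty (κ ↪ Fin (Fintype.card ι - 1)) :=
    Function.Embedding.nonempty_of_card_le (by simp; omega)
  have hmem (x : coordSphere (Option (Fin (Fintype.card ι - 1)))) :
      x.1 ∘ e.symm ∈ coordSphere ι := by
    exact (e.symm.sum_comp fun o ↦ x.1 o ^ 2).trans x.2
  have hcont : Continuous fun x ↦ f ⟨x.1 ∘ e.symm, hmem x⟩ :=
    hf.comp (((Pi.continuous_precomp e.symm).comp continuous_subtype_val).subtype_mk _)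
  obtain ⟨x, hx⟩ := exists_eq_zero_of_odd_option
    (fun x ↦ Function.extend j (f ⟨x.1 ∘ e.symm, hmem x⟩) 0) (by
      refine continuous_pi fun t ↦ ?_
      by_cases ht : ∃ s, j s = t
      · obtain ⟨s, rfl⟩ := ht
        simp only [j.injective.extend_apply]
        exact (continuous_apply s).comp hcont
      · simp only [Function.extend_apply' _ _ _ ht]
        exact continuous_const) (by
      intro x y hxy
      rw [hodd ⟨_, hmem x⟩ ⟨_, hmem y⟩ (by simp only [hxy]; rfl)]
      funext t
      by_cases ht : ∃ s, j s = t
      · obtain ⟨s, rfl⟩ := ht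
        simp only [Pi.neg_apply, j.injective.extend_apply]
      · simp [Function.extend_apply' _ _ _ ht])
  refine ⟨⟨_, hmem x⟩, funext fun s ↦ ?_⟩
  have := congrFun hx (j s)
  rwa [j.injective.extend_apply] at this

end BorsukUlam

section GramSchmidt

/-- Prepend a row to a matrix. -/
def prependRow {α : Type*} {k n : ℕ} (v : Fin n → α) (B : Matrix (Fin k) (Fin n) α) :
    Matrix (Fin (k + 1)) (Fin n) α :=
  Matrix.of fun i j ↦ Fin.cases (v j) (fun i ↦ B i j) i

@[simp]
lemma prependRow_zero {α : Type*} {k n : ℕ} (v : Fin n → α) (B : Matrix (Fin k) (Fin n) α)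
    (j : Fin n) : prependRow v B 0 j = v j := rfl

@[simp]
lemma prependRow_succ {α : Type*} {k n : ℕ} (v : Fin n → α) (B : Matrix (Fin k) (Fin n) α)
    (i : Fin k) (j : Fin n) : prependRow v B i.succ j = B i j := rfl

/-- Gram–Schmidt orthonormalization of a continuous family of quaternionic matrices with
independent rows; it commutes with negation. -/
lemma exists_continuous_orthonormalization {X : Type*} [TopologicalSpace X] {n : ℕ} (k : ℕ)
    (A : X → Matrix (Fin k) (Fin n) ℍ[ℝ]) (hA : Continuous A)
    (hind : ∀ x, ∀ c : Fin k → ℍ[ℝ], c ᵥ* A x = 0 → c = 0) :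
    ∃ Q : X → Matrix (Fin k) (Fin n) ℍ[ℝ], Continuous Q ∧ (∀ x, Q x * (Q x)ᴴ = 1) ∧
      (∀ x, ∃ T : Matrix (Fin k) (Fin k) ℍ[ℝ], Q x = T * A x) ∧
      ∀ x y, A y = -A x → Q y = -Q x := by
  induction k with
  | zero =>
    exact ⟨A, hA, fun x ↦ Subsingleton.elim _ _, fun x ↦ ⟨0, Subsingleton.elim _ _⟩,
      fun x y _ ↦ Subsingleton.elim _ _⟩
  | succ k ih =>
    have hcons (x) (a : ℍ[ℝ]) (c : Fin k → ℍ[ℝ]) :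
        vecCons a c ᵥ* A x = a • A x 0 + c ᵥ* (A x).submatrix Fin.succ id := by
      ext1 j
      simp [vecMul, dotProduct, Fin.sum_univ_succ]
    obtain ⟨B, hB, hB1, hBT, hBneg⟩ := ih (fun x ↦ (A x).submatrix Fin.succ id)
      (hA.matrix_submatrix _ _) (by
        intro x c hc
        have := hind x (vecCons 0 c) (by rw [hcons, hc]; simp)
        ext1 i
        simpa using congrFun this i.succ)
    let w : X → Fin n → ℍ[ℝ] := fun x ↦ A x 0 - (A x 0 ᵥ* (B x)ᴴ) ᵥ* B x
    have hw : Continuous w :=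
      ((continuous_apply 0).comp hA).sub
        ((((continuous_apply 0).comp hA).matrix_vecMul hB.matrix_conjTranspose).matrix_vecMul hB)
    have hwB (x) : w x ᵥ* (B x)ᴴ = 0 := by
      simp only [w, sub_vecMul, vecMul_vecMul]
      rw [Matrix.mul_assoc, hB1, Matrix.mul_one, sub_self]
    have hw_eq (x) : ∃ c : Fin (k + 1) → ℍ[ℝ], c 0 = 1 ∧ w x = c ᵥ* A x := by
      obtain ⟨T, hT⟩ := hBT x
      refine ⟨vecCons 1 (-((A x 0 ᵥ* (B x)ᴴ) ᵥ* T)), rfl, ?_⟩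
      rw [hcons, neg_vecMul, vecMul_vecMul, ← hT, one_smul, ← sub_eq_add_neg]
    have hw0 (x) : w x ≠ 0 := by
      intro h
      obtain ⟨c, hc, hwc⟩ := hw_eq x
      have := hind x c (hwc ▸ h)
      simp [this] at hc
    let r : X → ℝ := fun x ↦ √(∑ j, ‖w x j‖ ^ 2)
    have hr (x) : 0 < r x := by
      obtain ⟨j, hj⟩ := Function.ne_iff.1 (hw0 x)
      exact Real.sqrt_pos.2 (Finset.sum_pos' (fun i _ ↦ sq_nonneg _)
        ⟨j, Finset.mem_univ j, pow_pos (norm_pos_iff.2 hj) 2⟩)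
    have hrc : Continuous r := by
      refine (continuous_finsetSum _ fun j _ ↦ ?_).sqrt
      exact ((continuous_apply j).comp hw).norm.pow 2
    have hww (x) : ∑ j, w x j * star (w x j) = ((r x ^ 2 : ℝ) : ℍ[ℝ]) := by
      rw [Real.sq_sqrt (Finset.sum_nonneg fun i _ ↦ sq_nonneg _)]
      simp only [Quaternion.self_mul_star, Quaternion.normSq_eq_norm_mul_self, ← sq]
      exact (map_sum (algebraMap ℝ ℍ[ℝ]) _ _).symm
    have hwneg (x y) (h : A y = -A x) : w y = -w x := by
      have h' := hBneg x y (by rw [h]; rfl)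
      have h0 : A y 0 = -A x 0 := by rw [h]; rfl
      simp only [w, h0, h', conjTranspose_neg, neg_vecMul, vecMul_neg, neg_neg, neg_sub]
      abel
    refine ⟨fun x ↦ prependRow ((r x)⁻¹ • w x) (B x), ?_, fun x ↦ ?_, fun x ↦ ?_,
      fun x y h ↦ ?_⟩
    · refine continuous_matrix fun i j ↦ ?_
      refine Fin.cases ?_ (fun i ↦ ?_) i
      · exact (hrc.inv₀ fun x ↦ (hr x).ne').smul ((continuous_apply j).comp hw)
      · exact hB.matrix_elem i j
    · have h0 (i : Fin k) : ∑ j, w x j * star (B x i j) = 0 := congrFun (hwB x) i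
      have h0' (i : Fin k) : ∑ j, B x i j * star (w x j) = 0 := by
        simpa using congrArg star (h0 i)
      ext1 i j
      refine Fin.cases ?_ (fun i ↦ ?_) i <;> refine Fin.cases ?_ (fun j ↦ ?_) j
      · change ∑ j, (r x)⁻¹ • w x j * star ((r x)⁻¹ • w x j) = _
        have hrx := (hr x).ne'
        simp_rw [Quaternion.star_smul, smul_mul_assoc, mul_smul_comm]
        rw [← Finset.smul_sum, ← Finset.smul_sum, hww, Quaternion.smul_coe, Quaternion.smul_coe,
          Matrix.one_apply_eq, ← Quaternion.coe_one]
        congr 1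
        field_simp
      · change ∑ j', (r x)⁻¹ • w x j' * star (B x j j') = _
        simp_rw [smul_mul_assoc]
        rw [← Finset.smul_sum, h0, smul_zero, Matrix.one_apply_ne (Fin.succ_ne_zero j).symm]
      · change ∑ j', B x i j' * star ((r x)⁻¹ • w x j') = _
        simp_rw [Quaternion.star_smul, mul_smul_comm]
        rw [← Finset.smul_sum, h0', smul_zero, Matrix.one_apply_ne (Fin.succ_ne_zero i)]
      · have := congrFun (congrFun (hB1 x) i) j
        simpa [Matrix.mul_apply, Matrix.one_apply] using this
    · obtain ⟨T, hT⟩ := hBT x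
      obtain ⟨c, -, hc⟩ := hw_eq x
      refine ⟨prependRow ((r x)⁻¹ • c) (Matrix.of fun i ↦ vecCons 0 (T i)), ?_⟩
      ext1 i j
      refine Fin.cases ?_ (fun i ↦ ?_) i
      · simp [hc, Matrix.mul_apply, vecMul, dotProduct, Finset.smul_sum]
      · simp [hT, Matrix.mul_apply, Fin.sum_univ_succ]
    · have h' := hBneg x y (by rw [h]; rfl)
      have hrr : r y = r x := by simp [r, hwneg x y h]
      ext1 i j
      refine Fin.cases ?_ (fun i ↦ ?_) i
      · simp [hrr, hwneg x y h]
      · simp [h']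

end GramSchmidt

section Toeplitz

/-- The banded `k × n` Toeplitz matrix with symbol `v`. -/
noncomputable def bandedToeplitz {N : ℕ} (k n : ℕ) (v : Fin N → ℍ[ℝ]) :
    Matrix (Fin k) (Fin n) ℍ[ℝ] :=
  Matrix.of fun i j ↦ if h : (i : ℕ) ≤ j ∧ (j : ℕ) - i < N then v ⟨j - i, h.2⟩ else 0

lemma bandedToeplitz_rows_independent {N k n : ℕ} (hn : N + k ≤ n + 1) (v : Fin N → ℍ[ℝ])
    (hv : v ≠ 0) (c : Fin k → ℍ[ℝ]) (hc : c ᵥ* bandedToeplitz k n v = 0) : c = 0 := by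
  classical
  obtain ⟨p, hp, hmin⟩ : ∃ p, v p ≠ 0 ∧ ∀ q < p, v q = 0 := by
    obtain ⟨j, hj⟩ := Function.ne_iff.1 hv
    obtain ⟨p, hp⟩ := (Finset.univ.filter fun q ↦ v q ≠ 0).exists_minimal
      ⟨j, by simpa using hj⟩
    refine ⟨p, by simpa using hp.prop, fun q hq ↦ ?_⟩
    by_contra h
    exact hp.not_lt (by simpa using h) hq
  ext1 i
  induction hi : (i : ℕ) using Nat.strong_induction_on generalizing i with
  | _ t ih =>
  have hlt : (i : ℕ) + p < n := by omega
  have h := congrFun hc ⟨i + p, hlt⟩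
  simp only [vecMul, dotProduct, Pi.zero_apply] at h
  rw [Finset.sum_eq_single i] at h
  · simpa [bandedToeplitz, hp] using h
  · intro l _ hl
    rcases lt_or_gt_of_ne hl with h1 | h1
    · rw [ih l (by omega) l rfl, Pi.zero_apply, zero_mul]
    · simp only [bandedToeplitz, Matrix.of_apply]
      split_ifs with h2
      · rw [hmin _ (by rw [Fin.lt_def]; dsimp only; omega), mul_zero]
      · rw [mul_zero]
  · simp

lemma continuous_bandedToeplitz {N : ℕ} (k n : ℕ) :
    Continuous (bandedToeplitz (N := N) k n) := by
  refine continuous_matrix fun i j ↦ ?_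
  simp only [bandedToeplitz, Matrix.of_apply]
  split_ifs <;> fun_prop

lemma bandedToeplitz_neg {N : ℕ} (k n : ℕ) (v : Fin N → ℍ[ℝ]) :
    bandedToeplitz k n (-v) = -bandedToeplitz k n v := by
  ext1 i j
  simp only [bandedToeplitz, Matrix.of_apply, Matrix.neg_apply]
  split_ifs <;> simp

end Toeplitz

/-- The real coordinates of a quaternion. -/
def quaternionCoords (q : ℍ[ℝ]) : Fin 4 → ℝ := ![q.re, q.imI, q.imJ, q.imK]

lemma continuous_quaternionCoords : Continuous quaternionCoords := by
  refine continuous_pi fun i ↦ ?_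
  fin_cases i
  exacts [Quaternion.continuous_re, Quaternion.continuous_imI, Quaternion.continuous_imJ,
    Quaternion.continuous_imK]

lemma quaternionCoords_neg (q : ℍ[ℝ]) : quaternionCoords (-q) = -quaternionCoords q := by
  simp [quaternionCoords]

lemma eq_zero_of_quaternionCoords_eq_zero {q : ℍ[ℝ]} (h : quaternionCoords q = 0) : q = 0 := by
  have h0 := congrFun h 0
  have h1 := congrFun h 1
  have h2 := congrFun h 2
  have h3 := congrFun h 3
  simp only [quaternionCoords, cons_val, Pi.zero_apply] at h0 h1 h2 h3
  ext <;> simpa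

/-- The quaternionic vector with given real coordinates. -/
def quaternionVector {N : ℕ} (x : Fin N × Fin 4 → ℝ) (i : Fin N) : ℍ[ℝ] :=
  ⟨x (i, 0), x (i, 1), x (i, 2), x (i, 3)⟩

lemma continuous_quaternionVector {N : ℕ} : Continuous (quaternionVector (N := N)) := by
  refine continuous_pi fun i ↦ ?_
  have : (fun x : Fin N × Fin 4 → ℝ ↦ quaternionVector x i) = fun x ↦
      Quaternion.linearIsometryEquivTuple.symm (WithLp.toLp 2 fun t ↦ x (i, t)) := by
    ext1 x
    rw [Quaternion.linearIsometryEquivTuple_symm_apply]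
    rfl
  rw [this]
  fun_prop

lemma quaternionVector_neg {N : ℕ} (x : Fin N × Fin 4 → ℝ) :
    quaternionVector (-x) = -quaternionVector x := by
  ext1 i
  ext <;> rfl

lemma quaternionVector_ne_zero {N : ℕ} {x : Fin N × Fin 4 → ℝ}
    (hx : x ∈ coordSphere (Fin N × Fin 4)) : quaternionVector x ≠ 0 := by
  intro h
  have : x = 0 := by
    ext ⟨i, t⟩
    have hi := congrFun h i
    rw [Quaternion.ext_iff] at hi
    fin_cases t
    exacts [hi.1, hi.2.1, hi.2.2.1, hi.2.2.2]
  simp [coordSphere, this] at hx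

/-- If there exists an `S³`-equivariant continuous map `ℍV_{n,k} → S^{4m-1}`
(equivariant for the left unit-quaternion actions), then `m ≥ n - k + 1`. -/
theorem stmt5 (n k m : ℕ) (hk : 1 ≤ k) (hkn : k ≤ n) (hm : 1 ≤ m)
    (f : QStiefel n k → QSphere m) (hf : Continuous f)
    (heq : ∀ (q : ℍ[ℝ]), ‖q‖ = 1 → ∀ (A : QStiefel n k)
      (h : (q • A.1) * (q • A.1)ᴴ = 1),
      ∀ j : Fin m, (f ⟨q • A.1, h⟩).1 j = q * (f A).1 j) :
    m ≥ n - k + 1 := by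
  by_contra hlt
  let N := n - k + 1
  obtain ⟨Q, hQ, hQ1, -, hQneg⟩ := exists_continuous_orthonormalization k
    (fun x : coordSphere (Fin N × Fin 4) ↦ bandedToeplitz k n (quaternionVector x.1))
    ((continuous_bandedToeplitz k n).comp
      (continuous_quaternionVector.comp continuous_subtype_val))
    fun x ↦ bandedToeplitz_rows_independent (by omega) _ (quaternionVector_ne_zero x.2)
  have hcont : Continuous fun x ↦ f ⟨Q x, hQ1 x⟩ := hf.comp (hQ.subtype_mk _)
  obtain ⟨x, hx⟩ := exists_eq_zero_of_odd (κ := Fin m × Fin 4) (by simp [N]; omega)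
    (fun x jt ↦ quaternionCoords ((f ⟨Q x, hQ1 x⟩).1 jt.1) jt.2)
    (by
      refine continuous_pi fun jt ↦ ?_
      refine (continuous_apply jt.2).comp (continuous_quaternionCoords.comp ?_)
      exact (PiLp.continuous_apply 2 _ jt.1).comp (continuous_subtype_val.comp hcont))
    (by
      intro x y hxy
      have hneg : Q y = (-1 : ℍ[ℝ]) • Q x := by
        rw [hQneg x y (by rw [hxy, quaternionVector_neg, bandedToeplitz_neg]), neg_one_smul]
      have hmem : ((-1 : ℍ[ℝ]) • Q x) * ((-1 : ℍ[ℝ]) • Q x)ᴴ = 1 := hneg ▸ hQ1 y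
      have hval : (⟨Q y, hQ1 y⟩ : QStiefel n k) = ⟨(-1 : ℍ[ℝ]) • Q x, hmem⟩ :=
        Subtype.ext hneg
      ext1 jt
      have := heq (-1) (by simp) ⟨Q x, hQ1 x⟩ hmem jt.1
      rw [hval, this, neg_one_mul, quaternionCoords_neg]
      rfl)
  have hzero : (f ⟨Q x, hQ1 x⟩).1 = 0 := by
    ext1 j
    exact eq_zero_of_quaternionCoords_eq_zero (funext fun t ↦ congrFun hx (j, t))
  have hnorm := (f ⟨Q x, hQ1 x⟩).2
  rw [mem_sphere_zero_iff_norm, hzero, norm_zero] at hnorm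
  exact zero_ne_one hnorm
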